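/- Let q₁, q₂ > 1 be integers and let a₁, a₂ be integers with 1 ≤ aᵢ < qᵢ, gcd(aᵢ, qᵢ) = 1 for i = 1, 2, and a₁/q₁ ≠ a₂/q₂. Then the real number ψ(a₁/q₁) - ψ(a₂/q₂) is transcendental. -/

import Mathlib

/-- The digamma function `ψ(x) = -γ - 1/x + ∑_{n=1}^∞ (1/n - 1/(n+x))` for real `x`. -/
noncomputable def digamma (x : ℝ) : ℝ :=
  -Real.eulerMascheroniConstant - 1 / x +
    ∑' k : ℕ, (1 / ((k : ℝ) + 1) - 1 / (((k : ℝ) + 1) + x))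

section LinearFormsInLogarithms

open Polynomial

/-- The polynomial `∏ i, (u i + c i X) ^ τ i`, the symbol of the twisted differential operator. -/
noncomputable def twistSymbol {ι R : Type*} [Fintype ι] [CommRing R] (c : ι → R) (u τ : ι → ℕ) :
    R[X] :=
  ∏ i, (C (u i : R) + C (c i) * X) ^ τ i

/-- The differential operator `∏ i, (u i + c i d/dX) ^ τ i` acting on polynomials. -/
noncomputable def twist {ι R : Type*} [Fintype ι] [CommRing R] (c : ι → R) (u τ : ι → ℕ) :
    R[X] →ₗ[R] R[X] :=
  aeval (R := R) (A := Module.End R R[X]) derivative (twistSymbol c u τ)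

section Twist

variable {ι R : Type*} [Fintype ι] [CommRing R]

theorem twist_zero (c : ι → R) (u : ι → ℕ) (P : R[X]) : twist c u 0 P = P := by
  simp [twist, twistSymbol]

theorem twist_add_single [DecidableEq ι] (c : ι → R) (u τ : ι → ℕ) (i : ι) (P : R[X]) :
    twist c u (τ + Pi.single i 1) P =
      C (u i : R) * twist c u τ P + C (c i) * derivative (twist c u τ P) := by
  have h : twistSymbol c u (τ + Pi.single i 1) =
      (C (u i : R) + C (c i) * X) * twistSymbol c u τ := by
    simp only [twistSymbol, Pi.add_apply, pow_add, Finset.prod_mul_distrib]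
    rw [mul_comm]
    congr 1
    rw [Finset.prod_eq_single i] <;> simp +contextual
  simp only [twist, h, map_mul, map_add, aeval_C, aeval_X, Module.End.mul_apply,
    LinearMap.add_apply, Module.algebraMap_end_apply, smul_eq_C_mul]

theorem multiIndex_induction [DecidableEq ι] {motive : (ι → ℕ) → Prop} (zero : motive 0)
    (add_single : ∀ τ i, motive τ → motive (τ + Pi.single i 1)) (τ : ι → ℕ) : motive τ := by
  induction hN : ∑ i, τ i generalizing τ with
  | zero =>
    obtain rfl : τ = 0 := by ext i; simpa using (Finset.sum_eq_zero_iff.1 hN) i (Finset.mem_univ i)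
    exact zero
  | succ N ih =>
    obtain ⟨i, -, hi⟩ : ∃ i ∈ Finset.univ, τ i ≠ 0 := by
      apply Finset.exists_ne_zero_of_sum_ne_zero; omega
    have hτ : τ = (τ - Pi.single i 1) + Pi.single i 1 := by
      ext j
      by_cases hj : j = i
      · subst hj; simp; omega
      · simp [hj]
    rw [hτ]
    apply add_single
    apply ih
    rw [hτ] at hN
    simp only [Pi.add_apply, Finset.sum_add_distrib, Finset.sum_pi_single', Finset.mem_univ,
      if_true] at hN
    simpa using hN

theorem twist_map {S : Type*} [CommRing S] (f : R →+* S) (c : ι → R) (u τ : ι → ℕ) (P : R[X]) :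
    (twist c u τ P).map f = twist (fun i => f (c i)) u τ (P.map f) := by
  classical
  induction τ using multiIndex_induction with
  | zero => simp [twist_zero]
  | add_single τ i ih => simp [twist_add_single, ih, ← derivative_map]

theorem coeff_twist_eq_zero (c : ι → R) (u τ : ι → ℕ) {P : R[X]} {D : ℕ}
    (hP : ∀ k, D ≤ k → P.coeff k = 0) {k : ℕ} (hk : D ≤ k) : (twist c u τ P).coeff k = 0 := by
  classical
  induction τ using multiIndex_induction generalizing k with
  | zero => simpa [twist_zero] using hP k hk
  | add_single τ i ih =>
    simp [twist_add_single, coeff_derivative, ih hk, ih (k := k + 1) (by omega)]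

theorem coeff_twist_top (c : ι → R) (u τ : ι → ℕ) {P : R[X]} {D : ℕ}
    (hP : ∀ k, D < k → P.coeff k = 0) :
    (twist c u τ P).coeff D = (∏ i, (u i : R) ^ τ i) * P.coeff D := by
  classical
  induction τ using multiIndex_induction with
  | zero => simp [twist_zero]
  | add_single τ i ih =>
    have h := coeff_twist_eq_zero c u τ (D := D + 1) (P := P) (fun k hk => hP k hk) le_rfl
    simp only [twist_add_single, coeff_add, coeff_C_mul, coeff_derivative, h, ih, Pi.add_apply,
      pow_add, Finset.prod_mul_distrib]
    have : ∏ j, (u j : R) ^ (Pi.single i 1 : ι → ℕ) j = u i := by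
      rw [Finset.prod_eq_single i] <;> simp +contextual
    rw [this]; ring

end Twist

/-- The weighted `ℓ¹` norm of the coefficients below `N` of a complex polynomial. -/
noncomputable def coeffNorm (N : ℕ) (r : ℝ) (P : ℂ[X]) : ℝ :=
  ∑ k ∈ Finset.range N, ‖P.coeff k‖ * r ^ k

theorem coeffNorm_nonneg (N : ℕ) {r : ℝ} (hr : 0 ≤ r) (P : ℂ[X]) : 0 ≤ coeffNorm N r P :=
  Finset.sum_nonneg fun _ _ => by positivity

theorem norm_eval_le_coeffNorm {N : ℕ} {r : ℝ} {P : ℂ[X]} (hP : ∀ k, N ≤ k → P.coeff k = 0)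
    {x : ℂ} (hx : ‖x‖ ≤ r) : ‖P.eval x‖ ≤ coeffNorm N r P := by
  have hdeg : P.degree < N := (degree_lt_iff_coeff_zero _ _).2 hP
  by_cases hN : P = 0
  · subst hN; simp [coeffNorm]
  rw [eval_eq_sum_range' ((natDegree_lt_iff_degree_lt hN).2 hdeg)]
  refine (norm_sum_le _ _).trans (Finset.sum_le_sum fun k _ => ?_)
  rw [norm_mul, norm_pow]
  gcongr

theorem coeffNorm_derivative_le {N : ℕ} {r : ℝ} (hr : 1 ≤ r) {P : ℂ[X]}
    (hP : ∀ k, N ≤ k → P.coeff k = 0) :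
    coeffNorm N r (derivative P) ≤ N * coeffNorm N r P := by
  rw [coeffNorm, coeffNorm, Finset.mul_sum]
  have h1 : ∀ k ∈ Finset.range N, ‖(derivative P).coeff k‖ * r ^ k ≤
      N * (‖P.coeff (k + 1)‖ * r ^ (k + 1)) := by
    intro k hk
    have hk' : (k : ℝ) + 1 ≤ N := by exact_mod_cast Finset.mem_range.1 hk
    rw [coeff_derivative, norm_mul]
    have : ‖(k : ℂ) + 1‖ = (k : ℝ) + 1 := by
      rw [← Nat.cast_add_one, Complex.norm_natCast]; simp
    rw [this]
    calc ‖P.coeff (k + 1)‖ * ((k : ℝ) + 1) * r ^ k ≤ ‖P.coeff (k + 1)‖ * N * r ^ (k + 1) := by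
          gcongr
          omega
      _ = _ := by ring
  refine (Finset.sum_le_sum h1).trans ?_
  have h2 := Finset.sum_range_succ (fun k => (N : ℝ) * (‖P.coeff k‖ * r ^ k)) N
  rw [hP N le_rfl] at h2
  have h3 := Finset.sum_range_succ' (fun k => (N : ℝ) * (‖P.coeff k‖ * r ^ k)) N
  have h4 : 0 ≤ (N : ℝ) * (‖P.coeff 0‖ * r ^ 0) := by positivity
  simp only [norm_zero, zero_mul, mul_zero, add_zero] at h2
  linarith

theorem coeffNorm_twist_le {ι : Type*} [Fintype ι] {N M : ℕ} {B r : ℝ} (hr : 1 ≤ r)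
    {c : ι → ℂ} (hc : ∀ i, ‖c i‖ ≤ B) (hB : 0 ≤ B) {u : ι → ℕ} (hu : ∀ i, u i ≤ M) (τ : ι → ℕ)
    {P : ℂ[X]} (hP : ∀ k, N ≤ k → P.coeff k = 0) :
    coeffNorm N r (twist c u τ P) ≤ (M + B * N) ^ (∑ i, τ i) * coeffNorm N r P := by
  classical
  induction τ using multiIndex_induction with
  | zero => simp [twist_zero]
  | add_single τ i ih =>
    set Q := twist c u τ P
    have hQ : ∀ k, N ≤ k → Q.coeff k = 0 := fun k hk => coeff_twist_eq_zero c u τ hP hk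
    have hsum : ∑ j, (τ + Pi.single i 1 : ι → ℕ) j = ∑ j, τ j + 1 := by
      simp [Finset.sum_add_distrib]
    have hu' : (u i : ℝ) ≤ M := by exact_mod_cast hu i
    have hd := coeffNorm_derivative_le hr hQ
    have h0 := coeffNorm_nonneg N (zero_le_one.trans hr) Q
    have h1 := coeffNorm_nonneg N (zero_le_one.trans hr) (derivative Q)
    rw [twist_add_single, hsum]
    calc coeffNorm N r (C (u i : ℂ) * Q + C (c i) * derivative Q)
        ≤ u i * coeffNorm N r Q + ‖c i‖ * coeffNorm N r (derivative Q) := by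
          simp only [coeffNorm, Finset.mul_sum, ← Finset.sum_add_distrib]
          refine Finset.sum_le_sum fun k _ => ?_
          rw [← mul_assoc, ← mul_assoc, ← add_mul]
          gcongr
          rw [coeff_add, coeff_C_mul, coeff_C_mul]
          refine (norm_add_le _ _).trans (le_of_eq ?_)
          simp
      _ ≤ M * coeffNorm N r Q + B * (N * coeffNorm N r Q) := by
          gcongr
          exact hc i
      _ = (M + B * N) * coeffNorm N r Q := by ring
      _ ≤ (M + B * N) * ((M + B * N) ^ (∑ i, τ i) * coeffNorm N r P) := by gcongr
      _ = _ := by ring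

theorem coeff_comp_X_add_C_top {Q : ℂ[X]} {k : ℕ} (hQ : ∀ j, k < j → Q.coeff j = 0) (m : ℂ) :
    (Q.comp (X + C m)).coeff k = Q.coeff k := by
  rw [← taylor_apply, taylor_coeff]
  have : hasseDeriv k Q = C (Q.coeff k) := by
    ext j
    rw [hasseDeriv_coeff, coeff_C]
    split_ifs with hj
    · simp [hj]
    · simp [hQ (j + k) (by omega)]
  simp [this]

/-- An exponential polynomial with sufficiently many consecutive integral zeros vanishes. -/
theorem expPoly_eq_zero (M : Finset ℂ) {m : ℂ} (hm : m ≠ 0) (hM : ∀ μ ∈ M, μ ≠ 0)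
    (d : ℂ → ℕ) (Q : ℂ → ℂ[X]) (hQ : ∀ μ ∈ M, ∀ k, d μ ≤ k → (Q μ).coeff k = 0)
    (hz : ∀ s < ∑ μ ∈ M, d μ, ∑ μ ∈ M, μ ^ s * (Q μ).eval (m * s) = 0) :
    ∀ μ ∈ M, Q μ = 0 := by
  classical
  induction hN : ∑ μ ∈ M, d μ generalizing d Q with
  | zero =>
    intro μ hμ
    ext k
    have := (Finset.sum_eq_zero_iff.1 hN) μ hμ
    simpa using hQ μ hμ k (by omega)
  | succ N ih =>
    rw [hN] at hz
    obtain ⟨ν, hν, hdν⟩ : ∃ ν ∈ M, d ν ≠ 0 := by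
      apply Finset.exists_ne_zero_of_sum_ne_zero; omega
    let Q' : ℂ → ℂ[X] := fun μ => C μ * (Q μ).comp (X + C m) - C ν * Q μ
    let d' : ℂ → ℕ := fun μ => if μ = ν then d μ - 1 else d μ
    have hd' : ∑ μ ∈ M, d' μ = N := by
      have h1 := Finset.add_sum_erase M d hν
      have h2 := Finset.add_sum_erase M d' hν
      have h3 : ∑ μ ∈ M.erase ν, d' μ = ∑ μ ∈ M.erase ν, d μ :=
        Finset.sum_congr rfl fun μ hμ => by simp [d', Finset.ne_of_mem_erase hμ]
      have h4 : d' ν = d ν - 1 := by simp [d']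
      omega
    have key : ∀ μ ∈ M, Q' μ = 0 := by
      refine ih d' Q' (fun μ hμ k hk => ?_) (fun s hs => ?_) hd'
      · have hcomp : d μ ≤ k + 1 → ((Q μ).comp (X + C m)).coeff k = (Q μ).coeff k := fun h =>
          coeff_comp_X_add_C_top (fun j hj => hQ μ hμ j (by omega)) m
        by_cases hμν : μ = ν
        · subst hμν
          simp only [d', if_true] at hk
          simp [Q', hcomp (by omega)]
        · simp only [d', hμν, if_false] at hk
          simp [Q', hcomp (by omega), hQ μ hμ k hk]
      · have h1 := hz (s + 1) (by omega)
        have h0 := hz s (by omega)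
        calc ∑ μ ∈ M, μ ^ s * (Q' μ).eval (m * s)
            = ∑ μ ∈ M, μ ^ (s + 1) * (Q μ).eval (m * (s + 1 : ℕ)) -
              ν * ∑ μ ∈ M, μ ^ s * (Q μ).eval (m * s) := by
              rw [Finset.mul_sum, ← Finset.sum_sub_distrib]
              refine Finset.sum_congr rfl fun μ _ => ?_
              simp only [Q', eval_sub, eval_mul, eval_C, eval_comp, eval_add, eval_X]
              push_cast
              ring_nf
          _ = 0 := by rw [h1, h0]; simp
    have hne : ∀ μ ∈ M, μ ≠ ν → Q μ = 0 := by
      intro μ hμ hμν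
      by_contra h
      have h1 := congrArg (fun P => P.coeff (Q μ).natDegree) (key μ hμ)
      simp only [Q', coeff_sub, coeff_C_mul, coeff_zero,
        coeff_comp_X_add_C_top (fun j hj => coeff_eq_zero_of_natDegree_lt hj) m] at h1
      rw [← sub_mul, mul_eq_zero, sub_eq_zero] at h1
      exact h1.elim hμν (by simpa using h)
    intro μ hμ
    by_cases hμν : μ = ν
    swap
    · exact hne μ hμ hμν
    subst hμν
    have hper : ∀ x, (Q μ).eval (x + m) = (Q μ).eval x := by
      intro x
      have h1 := congrArg (eval x) (key μ hμ)
      simp only [Q', eval_sub, eval_mul, eval_C, eval_comp, eval_add, eval_X, eval_zero,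
        ← mul_sub, mul_eq_zero, sub_eq_zero] at h1
      exact h1.resolve_left (hM μ hμ)
    have h0 : (Q μ).eval 0 = 0 := by
      have := hz 0 (by omega)
      rw [Finset.sum_eq_single μ (fun b hb hbμ => by simp [hne b hb hbμ]) (by simp [hμ])] at this
      simpa using this
    have hall : ∀ s : ℕ, (Q μ).eval (s * m) = 0 := by
      intro s
      induction s with
      | zero => simpa using h0
      | succ s ih => rw [← ih, ← hper (s * m)]; push_cast; ring_nf
    refine eq_zero_of_infinite_isRoot _ ((Set.infinite_range_of_injective
      (f := fun s : ℕ => (s : ℂ) * m) fun a b hab => ?_).mono ?_)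
    · simpa [hm] using hab
    · rintro _ ⟨s, rfl⟩
      exact hall s

/-- Invertibility of the multivariate Vandermonde matrix on a grid. -/
theorem eq_zero_of_sum_prod_pow_eq_zero {ι : Type*} [Fintype ι] {L : ℕ}
    (I : Finset (ι → Fin L)) (b : (ι → Fin L) → ℂ)
    (h : ∀ τ : ι → Fin L, ∑ u ∈ I, (∏ i, ((u i : ℕ) : ℂ) ^ (τ i : ℕ)) * b u = 0) :
    ∀ u ∈ I, b u = 0 := by
  classical
  intro v hv
  let node : Fin L → ℂ := fun k => ((k : ℕ) : ℂ)
  have hnode : Set.InjOn node (Finset.univ : Finset (Fin L)) := by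
    intro a _ b _ hab
    simpa [node, Fin.ext_iff] using hab
  let g : Fin L → ℂ[X] := fun k => Lagrange.basis Finset.univ node k
  have hg : ∀ (i : ι) (u : ι → Fin L), (g (v i)).eval (node (u i)) =
      ∑ t : Fin L, (g (v i)).coeff t * ((u i : ℕ) : ℂ) ^ (t : ℕ) := by
    intro i u
    have hdeg : (g (v i)).natDegree < L := by
      have := Lagrange.natDegree_basis hnode (Finset.mem_univ (v i))
      have h2 := (v i).pos
      simp only [Finset.card_univ, Fintype.card_fin] at this
      simp only [g]; omega
    rw [eval_eq_sum_range' hdeg, Finset.sum_range]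
  have h1 : ∑ u ∈ I, (∏ i, (g (v i)).eval (node (u i))) * b u = 0 := by
    calc ∑ u ∈ I, (∏ i, (g (v i)).eval (node (u i))) * b u
        = ∑ u ∈ I, ∑ τ : ι → Fin L, (∏ i, (g (v i)).coeff (τ i)) *
            ((∏ i, ((u i : ℕ) : ℂ) ^ (τ i : ℕ)) * b u) := by
          refine Finset.sum_congr rfl fun u _ => ?_
          simp only [hg, Finset.prod_univ_sum, Finset.sum_mul, Fintype.piFinset_univ,
            Finset.prod_mul_distrib, mul_assoc]
      _ = 0 := by
          rw [Finset.sum_comm]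
          simp [← Finset.mul_sum, h]
  rw [Finset.sum_eq_single v] at h1
  · have h2 : ∏ i, (g (v i)).eval (node (v i)) = 1 :=
      Finset.prod_eq_one fun i _ => Lagrange.eval_basis_self hnode (Finset.mem_univ _)
    simpa [h2] using h1
  · intro u _ huv
    obtain ⟨i, hi⟩ : ∃ i, u i ≠ v i := by
      by_contra! hcon
      exact huv (funext hcon)
    rw [Finset.prod_eq_zero (Finset.mem_univ i)
      (Lagrange.eval_basis_of_ne (Ne.symm hi) (Finset.mem_univ _)), zero_mul]
  · simp [hv]

/-- Zero estimate: if all twisted exponential polynomials of small order have many integral zeros,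
then the underlying polynomials vanish. -/
theorem twist_zero_estimate {ι : Type*} [Fintype ι] [DecidableEq ι] {L N S T : ℕ} {m : ℂ}
    (hm : m ≠ 0)
    {c a : ι → ℂ} (ha : ∀ i, a i ≠ 0) (P : (ι → Fin L) → ℂ[X])
    (hP : ∀ u k, N ≤ k → (P u).coeff k = 0)
    (hS : N * L ^ Fintype.card ι ≤ S) (hT : Fintype.card ι * L < T)
    (hz : ∀ τ : ι → ℕ, ∑ i, τ i < T → ∀ s < S, ∑ u : ι → Fin L,
      (∏ i, a i ^ (u i : ℕ)) ^ s * (twist c (fun i => u i) τ (P u)).eval (m * s) = 0) :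
    ∀ u, P u = 0 := by
  classical
  let μ : (ι → Fin L) → ℂ := fun u => ∏ i, a i ^ (u i : ℕ)
  have hμ : ∀ u, μ u ≠ 0 := fun u => Finset.prod_ne_zero_iff.2 fun i _ => pow_ne_zero _ (ha i)
  let M : Finset ℂ := Finset.univ.image μ
  have hgroup : ∀ τ : ι → ℕ, ∑ i, τ i < T → ∀ ν ∈ M,
      ∑ u with μ u = ν, twist c (fun i => u i) τ (P u) = 0 := by
    intro τ hτ
    have hcard : ∑ ν ∈ M, N ≤ S := by
      rw [Finset.sum_const, smul_eq_mul, mul_comm]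
      refine le_trans (Nat.mul_le_mul_left _ ?_) hS
      refine Finset.card_image_le.trans ?_
      simp
    refine expPoly_eq_zero M hm (fun ν hν => ?_) (fun _ => N) _ (fun ν _ k hk => ?_)
      (fun s hs => ?_)
    · obtain ⟨u, -, rfl⟩ := Finset.mem_image.1 hν
      exact hμ u
    · rw [finsetSum_coeff]
      exact Finset.sum_eq_zero fun u _ => coeff_twist_eq_zero _ _ _ (hP u) hk
    · rw [← hz τ hτ s (hs.trans_le hcard),
        ← Finset.sum_fiberwise_of_maps_to (g := μ) (t := M)
          (fun u _ => Finset.mem_image_of_mem _ (Finset.mem_univ u))]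
      refine Finset.sum_congr rfl fun ν _ => ?_
      rw [eval_finsetSum, Finset.mul_sum]
      refine Finset.sum_congr rfl fun u hu => ?_
      rw [← (Finset.mem_filter.1 hu).2]
  have hcoeff : ∀ j k, N ≤ k + j → ∀ u, (P u).coeff k = 0 := by
    intro j
    induction j with
    | zero => exact fun k hk u => hP u k hk
    | succ j ih =>
      intro k hk u
      refine eq_zero_of_sum_prod_pow_eq_zero {v | μ v = μ u} (fun v => (P v).coeff k) (fun τ => ?_)
        u (by simp)
      have hτ : ∑ i, (τ i : ℕ) < T := by
        refine lt_of_le_of_lt ?_ hT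
        refine (Finset.sum_le_sum fun i _ => (τ i).2.le).trans ?_
        simp
      have h1 := congrArg (fun Q => Q.coeff k) (hgroup (fun i => τ i) hτ (μ u)
        (Finset.mem_image_of_mem _ (Finset.mem_univ u)))
      simp only [finsetSum_coeff, coeff_zero] at h1
      rw [← h1]
      refine Finset.sum_congr rfl fun v _ => ?_
      rw [coeff_twist_top _ _ _ fun l hl => ih l (by omega) v]
  intro u
  ext k
  simpa using hcoeff N k (by omega) u

theorem exists_entire_factor {f : ℂ → ℂ} (hf : Differentiable ℂ f) (w : ℂ) (T : ℕ)
    (hw : (T : ℕ∞) ≤ analyticOrderAt f w) :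
    ∃ g : ℂ → ℂ, Differentiable ℂ g ∧ ∀ z, f z = (z - w) ^ T * g z := by
  induction T generalizing f with
  | zero => exact ⟨f, hf, by simp⟩
  | succ T ih =>
    have h0 : f w = 0 := apply_eq_zero_of_analyticOrderAt_ne_zero (by
      rintro h; rw [h] at hw; simp at hw)
    have hg : Differentiable ℂ (dslope f w) := by
      rw [← differentiableOn_univ] at hf ⊢
      exact (Complex.differentiableOn_dslope (by simp)).2 hf
    have hfac : f = (fun z => z - w) * dslope f w := by
      ext z
      have := sub_smul_dslope f w z
      simp only [smul_eq_mul, h0, sub_zero] at this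
      exact this.symm
    have hord : (T : ℕ∞) ≤ analyticOrderAt (dslope f w) w := by
      rw [hfac, analyticOrderAt_mul (by fun_prop) (hg.analyticAt w)] at hw
      have h1 : analyticOrderAt (fun z : ℂ => z - w) w = 1 := by
        simp
      rw [h1, Nat.cast_add, Nat.cast_one, add_comm] at hw
      exact (ENat.add_le_add_iff_left ENat.one_ne_top).1 hw
    obtain ⟨g, hgd, hge⟩ := ih hg hord
    refine ⟨g, hgd, fun z => ?_⟩
    have := congrFun hfac z
    rw [this, Pi.mul_apply, hge]
    ring

theorem exists_entire_factor_prod {f : ℂ → ℂ} (hf : Differentiable ℂ f) (T S : ℕ)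
    (hz : ∀ j < S, (T : ℕ∞) ≤ analyticOrderAt f (j : ℂ)) :
    ∃ g : ℂ → ℂ, Differentiable ℂ g ∧
      ∀ z, f z = (∏ j ∈ Finset.range S, (z - j) ^ T) * g z := by
  induction S with
  | zero => exact ⟨f, hf, by simp⟩
  | succ S ih =>
    obtain ⟨g, hg, hfg⟩ := ih fun j hj => hz j (by omega)
    have hord : (T : ℕ∞) ≤ analyticOrderAt g (S : ℂ) := by
      have h1 := hz S (by omega)
      have h2 : f = (fun z : ℂ => ∏ j ∈ Finset.range S, (z - j) ^ T) * g := funext hfg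
      have h3 : AnalyticAt ℂ (fun z : ℂ => ∏ j ∈ Finset.range S, (z - j) ^ T) (S : ℂ) := by
        apply Differentiable.analyticAt
        fun_prop
      have h4 : analyticOrderAt (fun z : ℂ => ∏ j ∈ Finset.range S, (z - j) ^ T) (S : ℂ) = 0 := by
        rw [h3.analyticOrderAt_eq_zero, Finset.prod_ne_zero_iff]
        intro j hj
        have := Finset.mem_range.1 hj
        refine pow_ne_zero _ (sub_ne_zero.2 ?_)
        exact_mod_cast this.ne'
      rwa [h2, analyticOrderAt_mul h3 (hg.analyticAt _), h4, zero_add] at h1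
    obtain ⟨k, hk, hgk⟩ := exists_entire_factor hg S T hord
    refine ⟨k, hk, fun z => ?_⟩
    rw [hfg, hgk, Finset.prod_range_succ]
    ring

/-- A Schwarz lemma: an entire function with many zeros at `0, 1, …, S - 1` is small. -/
theorem norm_mul_pow_le_of_iteratedDeriv_eq_zero {f : ℂ → ℂ} (hf : Differentiable ℂ f) {T S s A : ℕ}
    (hA : 0 < A) (hS : S ≤ A) (hs : s ≤ A)
    (hz : ∀ j < S, ∀ r < T, iteratedDeriv r f (j : ℂ) = 0) {M : ℝ}
    (hM : ∀ z : ℂ, ‖z‖ = 4 * A → ‖f z‖ ≤ M) : ‖f s‖ * 3 ^ (S * T) ≤ M := by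
  obtain ⟨g, hg, hfg⟩ := exists_entire_factor_prod hf T S fun j hj =>
    (natCast_le_analyticOrderAt_iff_iteratedDeriv_eq_zero (hf.analyticAt _)).2 (hz j hj)
  have hA' : (0 : ℝ) < A := by exact_mod_cast hA
  have hbd : ∀ z : ℂ, ‖z‖ = 4 * A → ‖g z‖ ≤ M / (3 * A) ^ (S * T) := by
    intro z hzA
    rw [le_div_iff₀ (by positivity)]
    refine le_trans ?_ (hM z hzA)
    rw [hfg, norm_mul, mul_comm]
    gcongr
    rw [norm_prod]
    calc (3 * (A : ℝ)) ^ (S * T) = ∏ j ∈ Finset.range S, (3 * (A : ℝ)) ^ T := by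
          simp [← pow_mul, mul_comm]
      _ ≤ _ := by
          refine Finset.prod_le_prod (fun _ _ => by positivity) fun j hj => ?_
          rw [norm_pow]
          gcongr
          have h1 := norm_sub_norm_le z (j : ℂ)
          rw [hzA, Complex.norm_natCast] at h1
          have h2 : (j : ℝ) ≤ A := by
            exact_mod_cast (Finset.mem_range.1 hj).le.trans hS
          linarith
  have hgs : ‖g s‖ ≤ M / (3 * A) ^ (S * T) := by
    refine Complex.norm_le_of_forall_mem_frontier_norm_le (U := Metric.ball (0 : ℂ) (4 * A))
      Metric.isBounded_ball hg.diffContOnCl (fun z hz => ?_) (subset_closure ?_)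
    · rw [frontier_ball _ (by positivity)] at hz
      exact hbd z (by simpa using hz)
    · have : (s : ℝ) ≤ A := by exact_mod_cast hs
      simp
      linarith
  have hprod : ‖∏ j ∈ Finset.range S, ((s : ℂ) - j) ^ T‖ ≤ (A : ℝ) ^ (S * T) := by
    rw [norm_prod]
    calc _ ≤ ∏ j ∈ Finset.range S, (A : ℝ) ^ T := by
          refine Finset.prod_le_prod (fun _ _ => by positivity) fun j hj => ?_
          rw [norm_pow]
          gcongr
          have h1 : (j : ℝ) ≤ A := by
            exact_mod_cast (Finset.mem_range.1 hj).le.trans hS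
          have h2 : (s : ℝ) ≤ A := by exact_mod_cast hs
          have h3 : ((s : ℂ) - j) = (((s : ℝ) - j : ℝ) : ℂ) := by push_cast; rfl
          rw [h3, Complex.norm_real, Real.norm_eq_abs, abs_le]
          constructor <;> linarith [Nat.cast_nonneg (α := ℝ) j, Nat.cast_nonneg (α := ℝ) s]
      _ = _ := by simp [← pow_mul, mul_comm]
  rw [hfg, norm_mul]
  calc _ ≤ (A : ℝ) ^ (S * T) * (M / (3 * A) ^ (S * T)) * 3 ^ (S * T) := by gcongr
    _ = M := by
      rw [mul_pow]
      field_simp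

theorem norm_eval_twist_le {ι : Type*} [Fintype ι] {L N : ℕ} {B r H : ℝ} (hr : 1 ≤ r)
    (hB : 0 ≤ B) (hH : 0 ≤ H)
    {c : ι → ℂ} (hc : ∀ i, ‖c i‖ ≤ B) (u : ι → Fin L) (τ : ι → ℕ)
    {P : ℂ[X]} (hP : ∀ k, N ≤ k → P.coeff k = 0) (hPH : ∀ k, ‖P.coeff k‖ ≤ H)
    {x : ℂ} (hx : ‖x‖ ≤ r) :
    ‖(twist c (fun i => u i) τ P).eval x‖ ≤ (L + B * N) ^ (∑ i, τ i) * (N * H * r ^ N) := by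
  refine (norm_eval_le_coeffNorm (N := N) (fun k hk => coeff_twist_eq_zero _ _ _ hP hk) hx).trans ?_
  refine (coeffNorm_twist_le hr hc hB (fun i => (u i).2.le) τ hP).trans ?_
  gcongr
  calc coeffNorm N r P ≤ ∑ k ∈ Finset.range N, H * r ^ N := by
        refine Finset.sum_le_sum fun k hk => ?_
        have := Finset.mem_range.1 hk
        have h1 : r ^ k ≤ r ^ N := pow_le_pow_right₀ hr this.le
        exact mul_le_mul (hPH k) h1 (by positivity) hH
    _ = N * H * r ^ N := by simp; ring

section AuxiliaryFunction

variable {ι : Type*} [Fintype ι] [DecidableEq ι] {L : ℕ}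

/-- The `τ`-th derivative of the auxiliary function along the line through `ℓ`. -/
noncomputable def auxFun (m : ℂ) (c ℓ : ι → ℂ) (P : (ι → Fin L) → ℂ[X]) (τ : ι → ℕ) (z : ℂ) : ℂ :=
  ∑ u : ι → Fin L, Complex.exp ((∑ i, (u i : ℕ) * ℓ i) * z) *
    (twist c (fun i => u i) τ (P u)).eval (m * z)

theorem hasDerivAt_auxFun {m : ℂ} {c ℓ : ι → ℂ} (hm : ∑ i, c i * ℓ i = m)
    (P : (ι → Fin L) → ℂ[X]) (τ : ι → ℕ) (z : ℂ) :
    HasDerivAt (auxFun m c ℓ P τ) (∑ i, ℓ i * auxFun m c ℓ P (τ + Pi.single i 1) z) z := by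
  have h : ∑ i, ℓ i * auxFun m c ℓ P (τ + Pi.single i 1) z = ∑ u : ι → Fin L,
      (Complex.exp ((∑ i, (u i : ℕ) * ℓ i) * z) * (∑ i, (u i : ℕ) * ℓ i) *
        (twist c (fun i => u i) τ (P u)).eval (m * z) +
      Complex.exp ((∑ i, (u i : ℕ) * ℓ i) * z) *
        ((derivative (twist c (fun i => u i) τ (P u))).eval (m * z) * m)) := by
    simp only [auxFun, Finset.mul_sum]
    rw [Finset.sum_comm]
    refine Finset.sum_congr rfl fun u _ => ?_
    simp only [twist_add_single, eval_add, eval_mul, eval_C]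
    rw [← hm]
    simp only [Finset.mul_sum, Finset.sum_mul]
    rw [← Finset.sum_add_distrib]
    refine Finset.sum_congr rfl fun i _ => ?_
    ring
  rw [h]
  unfold auxFun
  refine HasDerivAt.fun_sum fun u _ => HasDerivAt.mul ?_ ?_
  · have := ((hasDerivAt_id z).const_mul (∑ i, ((u i : ℕ) : ℂ) * ℓ i)).cexp
    simpa using this
  · have h1 := (twist c (fun i => u i) τ (P u)).hasDerivAt (m * z)
    have h2 := (hasDerivAt_id z).const_mul m
    simpa [Function.comp_def] using h1.comp z h2

theorem differentiable_auxFun {m : ℂ} {c ℓ : ι → ℂ} (hm : ∑ i, c i * ℓ i = m)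
    (P : (ι → Fin L) → ℂ[X]) (τ : ι → ℕ) : Differentiable ℂ (auxFun m c ℓ P τ) :=
  fun z => (hasDerivAt_auxFun hm P τ z).differentiableAt

theorem iteratedDeriv_auxFun_eq_zero {m : ℂ} {c ℓ : ι → ℂ} (hm : ∑ i, c i * ℓ i = m)
    {P : (ι → Fin L) → ℂ[X]} {T : ℕ} {w : ℂ}
    (hz : ∀ τ : ι → ℕ, ∑ i, τ i < T → auxFun m c ℓ P τ w = 0) (r : ℕ) (τ : ι → ℕ)
    (hr : ∑ i, τ i + r < T) : iteratedDeriv r (auxFun m c ℓ P τ) w = 0 := by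
  induction r generalizing τ with
  | zero => simpa using hz τ hr
  | succ r ih =>
    have hd : deriv (auxFun m c ℓ P τ) =
        fun z => ∑ i, ℓ i * auxFun m c ℓ P (τ + Pi.single i 1) z :=
      funext fun z => (hasDerivAt_auxFun hm P τ z).deriv
    rw [iteratedDeriv_succ', hd, iteratedDeriv_fun_sum]
    · refine Finset.sum_eq_zero fun i _ => ?_
      rw [iteratedDeriv_const_mul_field, ih, mul_zero]
      simp [Finset.sum_add_distrib]
      omega
    · intro i _
      exact ((differentiable_auxFun hm P _).const_mul _).contDiff.contDiffAt

theorem norm_sum_mul_eval_twist_le {N : ℕ} {B r H E : ℝ} (hr : 1 ≤ r) (hB : 0 ≤ B) (hH : 0 ≤ H)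
    (hE : 0 ≤ E) {c : ι → ℂ} (hc : ∀ i, ‖c i‖ ≤ B) (τ : ι → ℕ) {P : (ι → Fin L) → ℂ[X]}
    (hP : ∀ u k, N ≤ k → (P u).coeff k = 0) (hPH : ∀ u k, ‖(P u).coeff k‖ ≤ H)
    {e : (ι → Fin L) → ℂ} (he : ∀ u, ‖e u‖ ≤ E) {x : ℂ} (hx : ‖x‖ ≤ r) :
    ‖∑ u, e u * (twist c (fun i => u i) τ (P u)).eval x‖ ≤
      L ^ Fintype.card ι * (E * ((L + B * N) ^ (∑ i, τ i) * (N * H * r ^ N))) := by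
  calc _ ≤ ∑ u : ι → Fin L, E * ((L + B * N) ^ (∑ i, τ i) * (N * H * r ^ N)) := by
        refine (norm_sum_le _ _).trans (Finset.sum_le_sum fun u _ => ?_)
        rw [norm_mul]
        exact mul_le_mul (he u) (norm_eval_twist_le hr hB hH hc u τ (hP u) (hPH u) hx)
          (norm_nonneg _) hE
    _ = _ := by simp

end AuxiliaryFunction

section Arithmetic

open NumberField

variable {K : Type*} [Field K] {ι : Type*} [Fintype ι] [DecidableEq ι] {L : ℕ}

/-- The algebraic integer whose complex embedding is the value at `s` of the auxiliary function. -/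
noncomputable def auxValue (m : ℤ) (a c : ι → 𝓞 K) (P : (ι → Fin L) → (𝓞 K)[X]) (τ : ι → ℕ)
    (s : ℕ) : 𝓞 K :=
  ∑ u : ι → Fin L,
    (∏ i, a i ^ (u i : ℕ)) ^ s * (twist c (fun i => u i) τ (P u)).eval ((m : 𝓞 K) * s)

theorem map_auxValue (f : 𝓞 K →+* ℂ) (m : ℤ) (a c : ι → 𝓞 K) (P : (ι → Fin L) → (𝓞 K)[X])
    (τ : ι → ℕ) (s : ℕ) :
    f (auxValue m a c P τ s) = ∑ u : ι → Fin L, (∏ i, f (a i) ^ (u i : ℕ)) ^ s *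
      (twist (fun i => f (c i)) (fun i => u i) τ ((P u).map f)).eval ((m : ℂ) * s) := by
  simp only [auxValue, map_sum, map_mul, map_pow, map_prod]
  refine Finset.sum_congr rfl fun u _ => ?_
  rw [← twist_map, ← eval_map_apply]
  simp

theorem auxFun_natCast (f : 𝓞 K →+* ℂ) (m : ℤ) (a c : ι → 𝓞 K) {ℓ : ι → ℂ}
    (hℓ : ∀ i, Complex.exp (ℓ i) = f (a i)) (P : (ι → Fin L) → (𝓞 K)[X])
    (τ : ι → ℕ) (s : ℕ) :
    auxFun m (fun i => f (c i)) ℓ (fun u => (P u).map f) τ s = f (auxValue m a c P τ s) := by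
  rw [map_auxValue, auxFun]
  refine Finset.sum_congr rfl fun u _ => ?_
  congr 1
  rw [mul_comm, Complex.exp_nat_mul, Complex.exp_sum]
  simp only [Complex.exp_nat_mul, hℓ]

variable [NumberField K]

theorem one_le_norm_mul_pow_of_house_le (φ : K →+* ℂ) {x : 𝓞 K} (hx : x ≠ 0) {G : ℝ}
    (hG : ∀ σ : K →+* ℂ, ‖σ x‖ ≤ G) : 1 ≤ ‖φ x‖ * G ^ (Module.finrank ℚ K - 1) := by
  have h1 := norm_norm_le_norm_mul_house_pow (x : K) φ
  have h2 : house (x : K) ≤ G := by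
    rw [house_eq_sup']
    have : (0 : ℝ) ≤ G := (norm_nonneg _).trans (hG φ)
    lift G to NNReal using this
    rw [NNReal.coe_le_coe]
    exact Finset.sup'_le _ _ fun σ _ => NNReal.coe_le_coe.1 (by simpa using hG σ)
  have h3 : (1 : ℝ) ≤ ‖Algebra.norm ℚ (x : K)‖ := by
    have h4 : Algebra.norm ℤ x ≠ 0 := Algebra.norm_ne_zero_iff.2 hx
    have h5 : Algebra.norm ℚ (x : K) = (Algebra.norm ℤ x : ℤ) :=
      (Algebra.coe_norm_int x).symm
    rw [h5]
    have h6 : (1 : ℤ) ≤ |Algebra.norm ℤ x| := Int.one_le_abs h4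
    have h7 : ‖((Algebra.norm ℤ x : ℤ) : ℚ)‖ = ((|Algebra.norm ℤ x| : ℤ) : ℝ) := by
      rw [Int.norm_cast_rat, Int.norm_eq_abs]; simp
    rw [h7]
    exact_mod_cast h6
  refine h3.trans (h1.trans ?_)
  have := house_nonneg (x : K)
  gcongr

/-- One step of the extrapolation: vanishing on `s < S` to order `2 T` implies vanishing on `s < A`
to order `T`. -/
theorem auxValue_extrapolation (φ : K →+* ℂ) {m : ℤ} {a c : ι → 𝓞 K} {ℓ : ι → ℂ}
    (hℓ : ∀ i, Complex.exp (ℓ i) = φ (a i)) (hm : ∑ i, φ (c i) * ℓ i = m)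
    {P : (ι → Fin L) → (𝓞 K)[X]} {S T A : ℕ} (hS : S ≤ A)
    (hz : ∀ τ : ι → ℕ, ∑ i, τ i < 2 * T → ∀ s < S, auxValue m a c P τ s = 0)
    {G : ℝ}
    (hG₁ : ∀ τ : ι → ℕ, ∑ i, τ i < T → ∀ s < A, ∀ σ : K →+* ℂ, ‖σ (auxValue m a c P τ s)‖ ≤ G)
    (hG₂ : ∀ τ : ι → ℕ, ∑ i, τ i < T → ∀ z : ℂ, ‖z‖ = 4 * A →
      ‖auxFun m (fun i => φ (c i)) ℓ
        (fun u => (P u).map (φ.comp (algebraMap (𝓞 K) K))) τ z‖ ≤ G)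
    (hG₃ : G ^ Module.finrank ℚ K < 3 ^ (S * T)) :
    ∀ τ : ι → ℕ, ∑ i, τ i < T → ∀ s < A, auxValue m a c P τ s = 0 := by
  intro τ hτ s hs
  by_contra hx
  set f : 𝓞 K →+* ℂ := φ.comp (algebraMap (𝓞 K) K) with hf
  have hval : ∀ (τ : ι → ℕ) (s : ℕ), auxFun m (fun i => φ (c i)) ℓ (fun u => (P u).map f) τ s =
      φ (auxValue m a c P τ s) := fun τ s => auxFun_natCast f m a c hℓ P τ s
  have h1 := one_le_norm_mul_pow_of_house_le φ hx (hG₁ τ hτ s hs)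
  have h2 := norm_mul_pow_le_of_iteratedDeriv_eq_zero (differentiable_auxFun hm
    (fun u => (P u).map f) τ) (T := T) (S := S) (s := s) (A := A) (by omega) hS hs.le
    (fun j hj r hr => iteratedDeriv_auxFun_eq_zero hm (T := 2 * T)
      (fun τ' hτ' => by rw [hval, hz τ' hτ' j hj]; simp) r τ (by omega)) (hG₂ τ hτ)
  rw [hval] at h2
  have hGpos : 0 ≤ G := (norm_nonneg _).trans (hG₁ τ hτ s hs φ)
  have hd : Module.finrank ℚ K = Module.finrank ℚ K - 1 + 1 := by
    have : 0 < Module.finrank ℚ K := Module.finrank_pos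
    omega
  rw [hd, pow_succ] at hG₃
  have h3 : (3 : ℝ) ^ (S * T) ≤ G ^ (Module.finrank ℚ K - 1) * G :=
    calc (3 : ℝ) ^ (S * T)
        ≤ (‖φ (auxValue m a c P τ s)‖ * G ^ (Module.finrank ℚ K - 1)) * 3 ^ (S * T) :=
          le_mul_of_one_le_left (by positivity) h1
      _ = G ^ (Module.finrank ℚ K - 1) * (‖φ (auxValue m a c P τ s)‖ * 3 ^ (S * T)) := by ring
      _ ≤ _ := by gcongr
  linarith

/-- Siegel's lemma over a number field, with exponent one. -/
theorem exists_siegel_const (K : Type*) [Field K] [NumberField K] : ∃ C : ℝ, 1 ≤ C ∧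
    ∀ (α β : Type) [Fintype α] [Fintype β] (M : Matrix α β (𝓞 K)) (A : ℝ), 1 ≤ A →
      (∀ k l, house (M k l : K) ≤ A) → 0 < Fintype.card α →
      2 * Fintype.card α ≤ Fintype.card β →
      ∃ ξ : β → 𝓞 K, ξ ≠ 0 ∧ M.mulVec ξ = 0 ∧
        ∀ l, house (ξ l : K) ≤ C * (C * Fintype.card β * A) := by
  classical
  obtain ⟨C, hC⟩ : ∃ C : ℝ, ∀ (α β : Type) [Fintype α] [Fintype β] (M : Matrix α β (𝓞 K)) (A : ℝ),
      M ≠ 0 → (∀ k l, house (M k l : K) ≤ A) → 0 < Fintype.card α →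
      Fintype.card α < Fintype.card β →
      ∃ ξ : β → 𝓞 K, ξ ≠ 0 ∧ M.mulVec ξ = 0 ∧
        ∀ l, house (ξ l : K) ≤ C * ((C * Fintype.card β * A) ^
          ((Fintype.card α : ℝ) / (Fintype.card β - Fintype.card α))) :=
    ⟨_, fun α β _ _ M A hM hA h0 hlt =>
      house.exists_ne_zero_int_vec_house_le K M hM h0 hlt rfl hA rfl⟩
  refine ⟨|C| + 1, by linarith [abs_nonneg C], fun α β _ _ M A hA1 hA h0 h2 => ?_⟩
  have hβ : (1 : ℝ) ≤ Fintype.card β := by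
    have : 1 ≤ Fintype.card β := by omega
    exact_mod_cast this
  have hbase : 1 ≤ (|C| + 1) * Fintype.card β * A := by
    have : 1 ≤ |C| + 1 := by linarith [abs_nonneg C]
    exact one_le_mul_of_one_le_of_one_le (one_le_mul_of_one_le_of_one_le this hβ) hA1
  by_cases hM : M = 0
  · have : Nonempty β := Fintype.card_pos_iff.1 (by omega)
    refine ⟨fun _ => 1, ?_, by simp [hM], fun l => ?_⟩
    · intro h
      exact one_ne_zero (congrFun h (Classical.arbitrary β))
    · have h1 : house ((1 : 𝓞 K) : K) = 1 := by
        simpa using house_intCast (K := K) 1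
      rw [h1]
      exact one_le_mul_of_one_le_of_one_le (by linarith [abs_nonneg C]) hbase
  · obtain ⟨ξ, h1, hξ2, h3⟩ := hC α β M A hM hA h0 (by omega)
    refine ⟨ξ, h1, hξ2, fun l => (h3 l).trans ?_⟩
    set e : ℝ := (Fintype.card α : ℝ) / (Fintype.card β - Fintype.card α) with he
    have hcast : 2 * (Fintype.card α : ℝ) ≤ Fintype.card β := by exact_mod_cast h2
    have hcast' : (0 : ℝ) < Fintype.card α := by exact_mod_cast h0
    have he1 : e ≤ 1 := by
      rw [he, div_le_one (by linarith)]
      linarith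
    have he0 : 0 ≤ e := div_nonneg hcast'.le (by linarith)
    calc C * (C * Fintype.card β * A) ^ e
        ≤ |C * (C * Fintype.card β * A) ^ e| := le_abs_self _
      _ = |C| * |(C * Fintype.card β * A) ^ e| := abs_mul _ _
      _ ≤ |C| * |C * Fintype.card β * A| ^ e := by
          gcongr
          exact Real.abs_rpow_le_abs_rpow _ _
      _ ≤ (|C| + 1) * ((|C| + 1) * Fintype.card β * A) ^ e := by
          rw [abs_mul, abs_mul, abs_of_nonneg (by linarith : (0 : ℝ) ≤ Fintype.card β),
            abs_of_nonneg (by linarith : (0 : ℝ) ≤ A)]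
          gcongr <;> linarith
      _ ≤ (|C| + 1) * ((|C| + 1) * Fintype.card β * A) ^ (1 : ℝ) := by
          gcongr
      _ = _ := by rw [Real.rpow_one]

end Arithmetic

section Core

open NumberField

/-- The powers of a large parameter dominate the upper bounds for the auxiliary function. -/
theorem auxBound_le {h n B b M t t₀ e : ℕ} {E H : ℝ} (hh : 2 ≤ h) (hB : B ≤ h)
    (hM : h ^ (2 * n + 2) ≤ M) (hE : E ≤ (h : ℝ) ^ (4 * n * B * M))
    (hH₀ : 0 ≤ H) (hH : H ≤ (h : ℝ) ^ (e * M)) (ht : t ≤ t₀ * M) :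
    ((h ^ (2 * n) : ℕ) : ℝ) ^ n * (E * ((((h ^ (2 * n) : ℕ) : ℝ) + B * (h ^ (2 * n + 2) : ℕ)) ^ t *
      (((h ^ (2 * n + 2) : ℕ) : ℝ) * H * ((h : ℝ) ^ b) ^ (h ^ (2 * n + 2))))) ≤
    (h : ℝ) ^ ((2 * n * n + 4 * n * B + (2 * n + 4) * t₀ + (2 * n + 2) + b + e) * M) := by
  have h1 : (1 : ℝ) ≤ h := by exact_mod_cast (by omega : 1 ≤ h)
  have hM1 : 1 ≤ M := le_trans (Nat.one_le_pow _ _ (by omega)) hM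
  have hL : ((h ^ (2 * n) : ℕ) : ℝ) + B * (h ^ (2 * n + 2) : ℕ) ≤ (h : ℝ) ^ (2 * n + 4) := by
    have : h ^ (2 * n) + B * h ^ (2 * n + 2) ≤ h ^ (2 * n + 4) :=
      calc h ^ (2 * n) + B * h ^ (2 * n + 2) ≤ h ^ (2 * n + 3) + h * h ^ (2 * n + 2) := by
            gcongr
            · omega
            · omega
        _ = 2 * h ^ (2 * n + 3) := by ring
        _ ≤ h * h ^ (2 * n + 3) := by gcongr
        _ = h ^ (2 * n + 4) := by ring
    exact_mod_cast this
  calc _ ≤ ((h : ℝ) ^ (2 * n)) ^ n * ((h : ℝ) ^ (4 * n * B * M) * (((h : ℝ) ^ (2 * n + 4)) ^ t *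
      ((h : ℝ) ^ (2 * n + 2) * (h : ℝ) ^ (e * M) * ((h : ℝ) ^ b) ^ (h ^ (2 * n + 2))))) := by
        push_cast at hL ⊢
        gcongr
    _ = (h : ℝ) ^ (2 * n * n + 4 * n * B * M + (2 * n + 4) * t + (2 * n + 2) + e * M +
          b * h ^ (2 * n + 2)) := by
        simp only [← pow_mul, pow_add]
        ring
    _ ≤ _ := by
        refine pow_le_pow_right₀ h1 ?_
        have e1 : 2 * n * n ≤ 2 * n * n * M := Nat.le_mul_of_pos_right _ hM1
        have e2 : (2 * n + 4) * t ≤ (2 * n + 4) * (t₀ * M) := Nat.mul_le_mul_left _ ht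
        have e3 : 2 * n + 2 ≤ (2 * n + 2) * M := Nat.le_mul_of_pos_right _ hM1
        have e4 : b * h ^ (2 * n + 2) ≤ b * M := Nat.mul_le_mul_left _ hM
        calc _ ≤ 2 * n * n * M + 4 * n * B * M + (2 * n + 4) * (t₀ * M) + (2 * n + 2) * M + e * M +
              b * M := by gcongr
          _ = _ := by ring

/-- Siegel's lemma yields a nontrivial family of polynomials of small height for which many values
of the auxiliary function vanish. -/
theorem exists_auxValue_eq_zero (K : Type*) [Field K] [NumberField K] : ∃ C : ℝ, 1 ≤ C ∧
    ∀ (ι : Type) [Fintype ι] [DecidableEq ι] (m : ℤ) (a c : ι → 𝓞 K) (L N S T : ℕ) (A : ℝ), 1 ≤ A →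
      (∀ (u : ι → Fin L) (τ : ι → ℕ) (s j : ℕ) (σ : K →+* ℂ), (∀ i, τ i < T) → s < S → j < N →
        ‖σ (((∏ i, a i ^ (u i : ℕ)) ^ s *
          (twist c (fun i => u i) τ (X ^ j)).eval ((m : 𝓞 K) * s) : 𝓞 K) : K)‖ ≤ A) →
      0 < S → 0 < T → 2 * (T ^ Fintype.card ι * S) ≤ N * L ^ Fintype.card ι →
      ∃ P : (ι → Fin L) → (𝓞 K)[X], P ≠ 0 ∧ (∀ u k, N ≤ k → (P u).coeff k = 0) ∧
        (∀ u k (σ : K →+* ℂ), ‖σ ((P u).coeff k)‖ ≤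
          C * (C * (N * L ^ Fintype.card ι : ℕ) * A)) ∧
        ∀ τ : ι → ℕ, (∀ i, τ i < T) → ∀ s < S, auxValue m a c P τ s = 0 := by
  obtain ⟨C₀, hC1, hC⟩ := exists_siegel_const K
  refine ⟨C₀, hC1, fun ι _ _ m a c L N S T A hA1 hA hS hT hcard => ?_⟩
  let M : Matrix ((ι → Fin T) × Fin S) (Fin N × (ι → Fin L)) (𝓞 K) := fun p q =>
    (∏ i, a i ^ (q.2 i : ℕ)) ^ (p.2 : ℕ) *
      (twist c (fun i => q.2 i) (fun i => p.1 i) (X ^ (q.1 : ℕ))).eval ((m : 𝓞 K) * (p.2 : ℕ))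
  have hM : ∀ p q, house (M p q : K) ≤ A := by
    rintro ⟨τ, s⟩ ⟨j, u⟩
    have h1 : ∀ σ : K →+* ℂ, ‖σ (M (τ, s) (j, u) : K)‖ ≤ A := fun σ =>
      hA u (fun i => τ i) s j σ (fun i => (τ i).2) s.2 j.2
    rw [house_eq_sup']
    lift A to NNReal using zero_le_one.trans hA1
    rw [NNReal.coe_le_coe]
    exact Finset.sup'_le _ _ fun σ _ => NNReal.coe_le_coe.1 (by simpa using h1 σ)
  obtain ⟨ξ, hξ0, hξ, hξb⟩ := hC _ _ M A hA1 hM (by simp [hS, hT]) (by simpa using hcard)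
  have hcoeff : ∀ (u : ι → Fin L) (k : ℕ),
      (∑ j : Fin N, C (ξ (j, u)) * X ^ (j : ℕ) : (𝓞 K)[X]).coeff k =
        if hk : k < N then ξ (⟨k, hk⟩, u) else 0 := by
    intro u k
    simp only [finsetSum_coeff, coeff_C_mul, coeff_X_pow]
    split_ifs with hk
    · rw [Finset.sum_eq_single ⟨k, hk⟩]
      · simp
      · intro b _ hb
        rw [if_neg, mul_zero]
        rintro rfl
        exact hb rfl
      · simp
    · refine Finset.sum_eq_zero fun j _ => ?_
      rw [if_neg, mul_zero]
      have := j.2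
      omega
  refine ⟨fun u => ∑ j : Fin N, C (ξ (j, u)) * X ^ (j : ℕ), ?_, ?_, ?_, ?_⟩
  · intro h0
    refine hξ0 (funext fun ⟨j, u⟩ => ?_)
    have := hcoeff u j
    rw [congrFun h0 u] at this
    simpa using this.symm
  · intro u k hk
    rw [hcoeff, dif_neg (by omega)]
  · intro u k σ
    rw [hcoeff]
    split_ifs with hk
    · simpa using (norm_embedding_le_house _ σ).trans (hξb (⟨k, hk⟩, u))
    · simp only [map_zero, norm_zero]
      positivity
  · intro τ hτ s hs
    have := congrFun hξ (fun i => ⟨τ i, hτ i⟩, ⟨s, hs⟩)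
    simp only [Matrix.mulVec, dotProduct, M, Pi.zero_apply] at this
    rw [Fintype.sum_prod_type, Finset.sum_comm] at this
    rw [← this, auxValue]
    refine Finset.sum_congr rfl fun u _ => ?_
    simp only [map_sum, eval_finsetSum, Finset.mul_sum]
    refine Finset.sum_congr rfl fun j _ => ?_
    rw [← smul_eq_C_mul, map_smul, eval_smul, smul_eq_mul]
    ring

theorem norm_prod_pow_pow_le {ι : Type*} [Fintype ι] {L s h B M : ℕ} {x : ι → ℂ} (hB1 : 1 ≤ B)
    (hB : B ≤ h) (hx : ∀ i, ‖x i‖ ≤ B) (u : ι → Fin L) (hM : L * s ≤ M) :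
    ‖(∏ i, x i ^ (u i : ℕ)) ^ s‖ ≤ (h : ℝ) ^ (4 * Fintype.card ι * B * M) := by
  have hB1' : (1 : ℝ) ≤ B := by exact_mod_cast hB1
  have hBh : (B : ℝ) ≤ h := by exact_mod_cast hB
  rw [norm_pow, norm_prod]
  calc (∏ i, ‖x i ^ (u i : ℕ)‖) ^ s ≤ (∏ _i : ι, (h : ℝ) ^ L) ^ s := by
        gcongr with i
        rw [norm_pow]
        calc ‖x i‖ ^ (u i : ℕ) ≤ (h : ℝ) ^ (u i : ℕ) := by
              gcongr
              exact (hx i).trans hBh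
          _ ≤ (h : ℝ) ^ L := pow_le_pow_right₀ (hB1'.trans hBh) (u i).2.le
    _ = (h : ℝ) ^ (Fintype.card ι * (L * s)) := by
        simp only [Finset.prod_const, Finset.card_univ, ← pow_mul]
        ring
    _ ≤ _ := by
        refine pow_le_pow_right₀ (hB1'.trans hBh) ?_
        calc Fintype.card ι * (L * s) ≤ Fintype.card ι * M := by gcongr
          _ ≤ 4 * B * (Fintype.card ι * M) := Nat.le_mul_of_pos_left _ (by omega)
          _ = _ := by ring

theorem norm_exp_sum_mul_le {ι : Type*} [Fintype ι] {L A h B M : ℕ} {ℓ : ι → ℂ} {z : ℂ}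
    (hh : 3 ≤ h) (hℓ : ∀ i, ‖ℓ i‖ ≤ B) (u : ι → Fin L) (hz : ‖z‖ ≤ 4 * A) (hM : L * A ≤ M) :
    ‖Complex.exp ((∑ i, (u i : ℕ) * ℓ i) * z)‖ ≤ (h : ℝ) ^ (4 * Fintype.card ι * B * M) := by
  have h1 : ‖(∑ i, ((u i : ℕ) : ℂ) * ℓ i) * z‖ ≤ (4 * Fintype.card ι * B * M : ℕ) := by
    rw [norm_mul]
    calc ‖∑ i, ((u i : ℕ) : ℂ) * ℓ i‖ * ‖z‖ ≤ (∑ _i : ι, (L : ℝ) * B) * (4 * A) := by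
          gcongr
          refine (norm_sum_le _ _).trans (Finset.sum_le_sum fun i _ => ?_)
          rw [norm_mul, Complex.norm_natCast]
          gcongr
          · exact (u i).2.le
          · exact hℓ i
      _ = ((4 * Fintype.card ι * B * (L * A) : ℕ) : ℝ) := by
          simp only [Finset.sum_const, Finset.card_univ, nsmul_eq_mul]
          push_cast
          ring
      _ ≤ _ := by
          norm_cast
          gcongr
  refine (Complex.norm_exp_le_exp_norm _).trans ((Real.exp_le_exp.2 h1).trans ?_)
  rw [← Real.exp_one_pow]
  gcongr
  have : (3 : ℝ) ≤ h := by exact_mod_cast hh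
  linarith [Real.exp_one_lt_three]

theorem exists_le_and_pow_lt_three_pow (x e : ℕ) : ∃ h : ℕ, x ≤ h ∧ (h : ℝ) ^ e < 3 ^ h := by
  have h1 := tendsto_pow_const_div_const_pow_of_one_lt e (r := 3) (by norm_num)
  have h2 := (h1.eventually (gt_mem_nhds one_pos)).and (Filter.eventually_ge_atTop x)
  obtain ⟨h, h3, h4⟩ := h2.exists
  exact ⟨h, h4, (div_lt_one (by positivity)).1 h3⟩

theorem exists_nat_forall_norm_le {ι : Type*} [Fintype ι] {E : Type*} [SeminormedAddGroup E]
    (f : ι → E) : ∃ B : ℕ, ∀ i, ‖f i‖ ≤ B := by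
  obtain ⟨B, hB⟩ := exists_nat_ge (∑ i, ‖f i‖)
  exact ⟨B, fun i => (Finset.single_le_sum (f := fun i => ‖f i‖) (fun _ _ => norm_nonneg _)
    (Finset.mem_univ i)).trans hB⟩

/-- Vanishing to order `2 ^ k₀ h ^ (2 n + 2)` at few points propagates to vanishing at many
points. -/
theorem auxValue_propagation {K : Type*} [Field K] [NumberField K] {ι : Type*} [Fintype ι]
    [DecidableEq ι] (φ : K →+* ℂ) {m : ℤ} {a c : ι → 𝓞 K} {ℓ : ι → ℂ}
    (hℓ : ∀ i, Complex.exp (ℓ i) = φ (a i)) (hm : ∑ i, φ (c i) * ℓ i = m)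
    {B h n k₀ e : ℕ} (hn : Fintype.card ι = n) (hB1 : 1 ≤ B) (hBh : B ≤ h) (hh : 4 ≤ h)
    (haB : ∀ i (σ : K →+* ℂ), ‖σ (a i)‖ ≤ B) (hcB : ∀ i (σ : K →+* ℂ), ‖σ (c i)‖ ≤ B)
    (hℓB : ∀ i, ‖ℓ i‖ ≤ B) (hmB : ‖m‖ ≤ B) {P : (ι → Fin (h ^ (2 * n))) → (𝓞 K)[X]}
    (hP : ∀ u k, h ^ (2 * n + 2) ≤ k → (P u).coeff k = 0)
    (hPH : ∀ u k (σ : K →+* ℂ), ‖σ ((P u).coeff k)‖ ≤ (h : ℝ) ^ (e * h ^ (2 * n + 2)))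
    (hlarge : (h : ℝ) ^
      ((2 * n * n + 4 * n * B + (2 * n + 4) * 2 ^ k₀ + (2 * n + 2) + (k₀ + 4) + e) *
        Module.finrank ℚ K) < 3 ^ h)
    (hz : ∀ τ : ι → ℕ, ∑ i, τ i < 2 ^ k₀ * h ^ (2 * n + 2) → ∀ s < h, auxValue m a c P τ s = 0)
    {k : ℕ} (hk : k ≤ k₀) :
    ∀ τ : ι → ℕ, ∑ i, τ i < 2 ^ (k₀ - k) * h ^ (2 * n + 2) → ∀ s < h ^ (k + 1),
      auxValue m a c P τ s = 0 := by
  have h1 : (1 : ℝ) ≤ h := by exact_mod_cast (by omega : 1 ≤ h)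
  induction k with
  | zero => simpa using hz
  | succ k ih =>
    have ih := ih (by omega)
    set M := h ^ (2 * n + 2 + k) with hMdef
    have hM : h ^ (2 * n + 2) ≤ M := Nat.pow_le_pow_right (by omega) (by omega)
    have hM1 : 1 ≤ M := Nat.one_le_pow _ _ (by omega)
    have hLM : h ^ (2 * n) * h ^ (k + 1 + 1) ≤ M := by
      rw [hMdef, ← pow_add]
      exact Nat.pow_le_pow_right (by omega) (by omega)
    have hT : 2 * (2 ^ (k₀ - (k + 1)) * h ^ (2 * n + 2)) = 2 ^ (k₀ - k) * h ^ (2 * n + 2) := by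
      have : k₀ - k = k₀ - (k + 1) + 1 := by omega
      rw [this, pow_succ]
      ring
    have hτM : ∀ τ : ι → ℕ, ∑ i, τ i < 2 ^ (k₀ - (k + 1)) * h ^ (2 * n + 2) →
        ∑ i, τ i ≤ 2 ^ k₀ * M := fun τ hτ => hτ.le.trans
      (Nat.mul_le_mul (Nat.pow_le_pow_right (by norm_num) (by omega)) hM)
    have hH : (h : ℝ) ^ (e * h ^ (2 * n + 2)) ≤ (h : ℝ) ^ (e * M) :=
      pow_le_pow_right₀ h1 (Nat.mul_le_mul_left _ hM)
    have hr : ∀ z : ℂ, ‖z‖ ≤ 4 * (h ^ (k + 1 + 1) : ℕ) → ‖(m : ℂ) * z‖ ≤ (h : ℝ) ^ (k₀ + 4) := by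
      intro z hz
      rw [norm_mul, Complex.norm_intCast, ← Int.norm_eq_abs]
      calc ‖m‖ * ‖z‖ ≤ B * (4 * (h ^ (k + 1 + 1) : ℕ)) := by gcongr
        _ ≤ ((h * (h * h ^ (k + 1 + 1)) : ℕ) : ℝ) := by
            norm_cast
            gcongr
        _ ≤ (h : ℝ) ^ (k₀ + 4) := by
            rw [← pow_succ', ← pow_succ', Nat.cast_pow]
            exact pow_le_pow_right₀ h1 (by omega)
    refine auxValue_extrapolation φ hℓ hm (S := h ^ (k + 1))
      (G := (h : ℝ) ^
        ((2 * n * n + 4 * n * B + (2 * n + 4) * 2 ^ k₀ + (2 * n + 2) + (k₀ + 4) + e) * M))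
      (Nat.pow_le_pow_right (by omega) (by omega)) (by rw [hT]; exact ih) ?_ ?_ ?_
    · intro τ hτ s hs σ
      have hval := map_auxValue (σ.comp (algebraMap (𝓞 K) K)) m a c P τ s
      rw [RingHom.comp_apply] at hval
      rw [hval]
      refine (norm_sum_mul_eval_twist_le (N := h ^ (2 * n + 2)) (one_le_pow₀ h1 (n := k₀ + 4))
        (Nat.cast_nonneg B) (H := (h : ℝ) ^ (e * M)) (by positivity)
        (E := (h : ℝ) ^ (4 * n * B * M)) (by positivity) (fun i => hcB i σ) τ
        (fun u k hk => by simp [hP u k hk])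
        (fun u k => by simpa using (hPH u k σ).trans hH) (fun u => ?_) (hr s ?_)).trans ?_
      · have := norm_prod_pow_pow_le hB1 hBh (fun i => haB i σ) u
          (le_trans (Nat.mul_le_mul_left _ hs.le) hLM)
        rwa [hn] at this
      · rw [Complex.norm_natCast]
        have : (s : ℝ) ≤ (h ^ (k + 1 + 1) : ℕ) := by exact_mod_cast hs.le
        linarith [Nat.cast_nonneg (α := ℝ) s]
      · rw [hn]
        exact auxBound_le (by omega) hBh hM le_rfl (by positivity) le_rfl (hτM τ hτ)
    · intro τ hτ z hz
      refine (norm_sum_mul_eval_twist_le (N := h ^ (2 * n + 2)) (one_le_pow₀ h1 (n := k₀ + 4))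
        (Nat.cast_nonneg B) (H := (h : ℝ) ^ (e * M)) (by positivity)
        (E := (h : ℝ) ^ (4 * n * B * M)) (by positivity) (fun i => hcB i φ) τ
        (fun u k hk => by simp [hP u k hk])
        (fun u k => by simpa using (hPH u k φ).trans hH) (fun u => ?_) (hr z hz.le)).trans ?_
      · have := norm_exp_sum_mul_le (h := h) (by omega) hℓB u hz.le hLM
        rwa [hn] at this
      · rw [hn]
        exact auxBound_le (by omega) hBh hM le_rfl (by positivity) le_rfl (hτM τ hτ)
    · rw [← pow_mul, mul_right_comm, pow_mul]
      calc _ < ((3 : ℝ) ^ h) ^ M := pow_lt_pow_left₀ hlarge (by positivity) (by omega)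
        _ = 3 ^ (h * M) := (pow_mul _ _ _).symm
        _ ≤ _ := by
            refine pow_le_pow_right₀ (by norm_num) ?_
            calc h * M = h ^ (k + 1) * (1 * h ^ (2 * n + 2)) := by rw [hMdef]; ring
              _ ≤ _ := by
                  gcongr
                  exact Nat.one_le_two_pow

/-- The inhomogeneous form of Baker's theorem: a linear combination of logarithms of algebraic
integers with algebraic integer coefficients is never a nonzero rational integer. -/
theorem sum_mul_log_ne_intCast {K : Type*} [Field K] [NumberField K] {ι : Type} [Fintype ι]
    (φ : K →+* ℂ) {m : ℤ} (hm0 : m ≠ 0) (a c : ι → 𝓞 K) (ℓ : ι → ℂ)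
    (hℓ : ∀ i, Complex.exp (ℓ i) = φ (a i)) : ∑ i, φ (c i) * ℓ i ≠ m := by
  classical
  intro hm
  obtain ⟨C₀, hC1, hC⟩ := exists_auxValue_eq_zero K
  obtain ⟨B₁, hB₁⟩ := exists_nat_forall_norm_le (fun p : ι × (K →+* ℂ) => p.2 (a p.1))
  obtain ⟨B₂, hB₂⟩ := exists_nat_forall_norm_le (fun p : ι × (K →+* ℂ) => p.2 (c p.1))
  obtain ⟨B₃, hB₃⟩ := exists_nat_forall_norm_le ℓ
  obtain ⟨C₁, hC₁⟩ := exists_nat_ge C₀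
  set n := Fintype.card ι with hn
  obtain ⟨B, hB⟩ : ∃ B : ℕ, B = B₁ + B₂ + B₃ + m.natAbs + 1 := ⟨_, rfl⟩
  obtain ⟨k₀, hk₀⟩ : ∃ k₀ : ℕ, k₀ = 2 * n * n + 2 * n + 2 := ⟨_, rfl⟩
  obtain ⟨D, hD⟩ : ∃ D : ℕ, D = 2 * n * n + 4 * n * B + (2 * n + 4) * (n * 2 ^ k₀) + (2 * n + 2) +
    (k₀ + 4) := ⟨_, rfl⟩
  obtain ⟨e, he⟩ : ∃ e : ℕ, e = k₀ + 2 + D := ⟨_, rfl⟩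
  obtain ⟨h, hlow, hlarge⟩ := exists_le_and_pow_lt_three_pow
    (4 + B + C₁ + n + 2 * (2 ^ k₀) ^ n)
    ((2 * n * n + 4 * n * B + (2 * n + 4) * 2 ^ k₀ + (2 * n + 2) + (k₀ + 4) + e) *
      Module.finrank ℚ K)
  have hpow : 0 < (2 ^ k₀) ^ n := by positivity
  have hpos : 0 < h := by omega
  have h1 : (1 : ℝ) ≤ h := by exact_mod_cast (by omega : 1 ≤ h)
  have hle : ∀ {x y : ℕ}, x ≤ y → (x : ℝ) ≤ y := fun h => by exact_mod_cast h
  have haB : ∀ i (σ : K →+* ℂ), ‖σ (a i)‖ ≤ B := fun i σ => (hB₁ (i, σ)).trans (hle (by omega))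
  have hcB : ∀ i (σ : K →+* ℂ), ‖σ (c i)‖ ≤ B := fun i σ => (hB₂ (i, σ)).trans (hle (by omega))
  have hℓB : ∀ i, ‖ℓ i‖ ≤ B := fun i => (hB₃ i).trans (hle (by omega))
  have hmB : ‖m‖ ≤ B := by
    rw [Int.norm_eq_abs, ← Int.cast_abs, Int.abs_eq_natAbs]
    exact_mod_cast (by omega : m.natAbs ≤ B)
  have hM1 : 1 ≤ h ^ (2 * n + 2) := Nat.one_le_pow _ _ (by omega)
  have hentry : ∀ (u : ι → Fin (h ^ (2 * n))) (τ : ι → ℕ) (s j : ℕ) (σ : K →+* ℂ),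
      (∀ i, τ i < 2 ^ k₀ * h ^ (2 * n + 2)) → s < h → j < h ^ (2 * n + 2) →
      ‖σ (((∏ i, a i ^ (u i : ℕ)) ^ s *
        (twist c (fun i => u i) τ (X ^ j)).eval ((m : 𝓞 K) * s) : 𝓞 K) : K)‖ ≤
      (h : ℝ) ^ (D * h ^ (2 * n + 2)) := by
    intro u τ s j σ hτ hs hj
    set f : 𝓞 K →+* ℂ := σ.comp (algebraMap (𝓞 K) K) with hf
    have hval : σ (((∏ i, a i ^ (u i : ℕ)) ^ s *
        (twist c (fun i => u i) τ (X ^ j)).eval ((m : 𝓞 K) * s) : 𝓞 K) : K) =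
        (∏ i, f (a i) ^ (u i : ℕ)) ^ s *
          (twist (fun i => f (c i)) (fun i => u i) τ (X ^ j)).eval ((m : ℂ) * s) := by
      change f _ = _
      have h2 := twist_map f c (fun i => u i) τ (X ^ j)
      rw [Polynomial.map_pow, map_X] at h2
      rw [← h2, map_mul, ← eval_map_apply]
      simp
    have hsum : ∑ i, τ i ≤ n * 2 ^ k₀ * h ^ (2 * n + 2) := by
      calc ∑ i, τ i ≤ ∑ _i : ι, 2 ^ k₀ * h ^ (2 * n + 2) :=
            Finset.sum_le_sum fun i _ => (hτ i).le
        _ = _ := by simp [hn, mul_assoc]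
    have hsm : ‖(m : ℂ) * s‖ ≤ (h : ℝ) ^ (k₀ + 4) := by
      rw [norm_mul, Complex.norm_intCast, ← Int.norm_eq_abs, Complex.norm_natCast]
      calc ‖m‖ * s ≤ h * h := by
            gcongr
            exact hmB.trans (hle (by omega))
        _ = (h : ℝ) ^ 2 := by ring
        _ ≤ _ := pow_le_pow_right₀ h1 (by omega)
    have hE := norm_prod_pow_pow_le (h := h) (M := h ^ (2 * n + 2)) (by omega : 1 ≤ B) (by omega)
      (fun i => haB i σ) u (s := s) (by
        rw [pow_add]
        gcongr
        nlinarith)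
    have hev := norm_eval_twist_le (N := h ^ (2 * n + 2)) (one_le_pow₀ h1 (n := k₀ + 4))
      (Nat.cast_nonneg B) (H := 1) (by positivity) (fun i => hcB i σ) u τ (P := X ^ j)
      (fun k hk => by rw [coeff_X_pow, if_neg (by omega)])
      (fun k => by rw [coeff_X_pow]; split_ifs <;> simp) hsm
    rw [hval, norm_mul]
    refine (mul_le_mul hE hev (norm_nonneg _) (by positivity)).trans ?_
    have hL : (1 : ℝ) ≤ ((h ^ (2 * n) : ℕ) : ℝ) := by exact_mod_cast Nat.one_le_pow _ _ hpos
    refine (le_mul_of_one_le_left (by positivity) (one_le_pow₀ hL (n := n))).trans ?_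
    have := auxBound_le (n := n) (b := k₀ + 4) (H := 1) (e := 0) (by omega)
      (by omega : B ≤ h) le_rfl le_rfl zero_le_one (by simp) hsum
    rw [add_zero, ← hD] at this
    exact this
  have hcard : 2 * ((2 ^ k₀ * h ^ (2 * n + 2)) ^ n * h) ≤ h ^ (2 * n + 2) * (h ^ (2 * n)) ^ n := by
    calc 2 * ((2 ^ k₀ * h ^ (2 * n + 2)) ^ n * h)
        = (2 * (2 ^ k₀) ^ n) * (h * (h ^ (2 * n + 2)) ^ n) := by ring
      _ ≤ h * (h * (h ^ (2 * n + 2)) ^ n) := by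
          gcongr
          omega
      _ = _ := by ring
  obtain ⟨P, hP0, hPN, hPH, hPz⟩ := hC ι m a c (h ^ (2 * n)) (h ^ (2 * n + 2)) h
    (2 ^ k₀ * h ^ (2 * n + 2)) ((h : ℝ) ^ (D * h ^ (2 * n + 2))) (one_le_pow₀ h1) hentry hpos
    (by positivity) hcard
  · have hz := auxValue_propagation φ hℓ hm hn.symm (by omega) (by omega) (by omega) haB hcB hℓB hmB
      hPN (e := e) (fun u k σ => (hPH u k σ).trans ?_) hlarge
      (fun τ hτ s hs => hPz τ (fun i => lt_of_le_of_lt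
        (Finset.single_le_sum (fun _ _ => Nat.zero_le _) (Finset.mem_univ i)) hτ) s hs) le_rfl
    · have hzero := twist_zero_estimate (L := h ^ (2 * n)) (N := h ^ (2 * n + 2))
        (S := h ^ (k₀ + 1)) (T := h ^ (2 * n + 2)) (m := m) (by exact_mod_cast hm0) (c := fun i => φ (c i))
        (a := fun i => φ (a i)) (fun i => by rw [← hℓ]; exact Complex.exp_ne_zero _)
        (fun u => (P u).map (φ.comp (algebraMap (𝓞 K) K)))
        (fun u k hk => by simp [hPN u k hk]) ?_ ?_ ?_
      · refine hP0 (funext fun u => ?_)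
        have := hzero u
        rwa [Polynomial.map_eq_zero_iff
          (f := φ.comp (algebraMap (𝓞 K) K))
          (φ.injective.comp (FaithfulSMul.algebraMap_injective (𝓞 K) K))] at this
      · rw [← pow_mul, ← pow_add]
        refine Nat.pow_le_pow_right (by omega) ?_
        rw [hk₀, ← hn]
        nlinarith
      · rw [← hn, pow_add, mul_comm]
        refine Nat.mul_lt_mul_of_pos_left ?_ (by positivity)
        nlinarith
      · intro τ hτ s hs
        have h0 := hz τ (by simpa using hτ) s hs
        have hval := map_auxValue (φ.comp (algebraMap (𝓞 K) K)) m a c P τ s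
        rw [h0, map_zero] at hval
        exact hval.symm
    · calc C₀ * (C₀ * (h ^ (2 * n + 2) * (h ^ (2 * n)) ^ Fintype.card ι : ℕ) *
            (h : ℝ) ^ (D * h ^ (2 * n + 2)))
          ≤ h * (h * (h ^ (2 * n + 2) * (h ^ (2 * n)) ^ n : ℕ) *
            (h : ℝ) ^ (D * h ^ (2 * n + 2))) := by
            have : C₀ ≤ h := hC₁.trans (hle (by omega))
            gcongr
        _ = (h : ℝ) ^ (k₀ + 2 + D * h ^ (2 * n + 2)) := by
            rw [hk₀]
            push_cast
            ring
        _ ≤ _ := by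
            refine pow_le_pow_right₀ h1 ?_
            rw [he, add_mul]
            gcongr
            exact Nat.le_mul_of_pos_right _ hM1

end Core

end LinearFormsInLogarithms

section LogSeries

open Filter Topology

theorem sum_range_mul_eq_sum_sum {M : Type*} [AddCommMonoid M] (f : ℕ → M) (q K : ℕ) :
    ∑ i ∈ Finset.range (K * q), f i =
      ∑ k ∈ Finset.range K, ∑ i ∈ Finset.range q, f (k * q + i) := by
  induction K with
  | zero => simp
  | succ K ih => rw [add_mul, one_mul, Finset.sum_range_add, ih, Finset.sum_range_succ]

/-- If the terms tend to zero, partial sums converge as soon as the sums over blocks do. -/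
theorem tendsto_sum_range_of_tendsto_sum_blocks {f : ℕ → ℂ} {q : ℕ} (hq : q ≠ 0) {l : ℂ}
    (hf : Tendsto f atTop (𝓝 0))
    (h : Tendsto (fun K => ∑ k ∈ Finset.range K, ∑ i ∈ Finset.range q, f (k * q + i)) atTop (𝓝 l)) :
    Tendsto (fun n => ∑ i ∈ Finset.range n, f i) atTop (𝓝 l) := by
  have hdiv := Nat.tendsto_div_const_atTop hq
  have hrem : Tendsto (fun n => ∑ i ∈ Finset.range q,
      if i < n % q then f (n / q * q + i) else 0) atTop (𝓝 0) := by
    rw [← Finset.sum_const_zero (s := Finset.range q)]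
    refine tendsto_finsetSum _ fun i _ => ?_
    have h1 : Tendsto (fun n => f (n / q * q + i)) atTop (𝓝 0) :=
      hf.comp (tendsto_atTop_mono (fun n => by
        have : n / q ≤ n / q * q := Nat.le_mul_of_pos_right _ (Nat.pos_of_ne_zero hq)
        exact this.trans (Nat.le_add_right _ i)) hdiv)
    refine squeeze_zero_norm (fun n => ?_) (tendsto_zero_iff_norm_tendsto_zero.1 h1)
    split_ifs <;> simp
  have := (h.comp hdiv).add hrem
  rw [add_zero] at this
  refine this.congr fun n => ?_
  rw [Function.comp_apply, ← sum_range_mul_eq_sum_sum]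
  conv_rhs => rw [← Nat.div_add_mod' n q, Finset.sum_range_add]
  congr 1
  rw [← Finset.sum_filter]
  refine Finset.sum_congr ?_ fun _ _ => rfl
  ext i
  have := Nat.mod_lt n (Nat.pos_of_ne_zero hq)
  simp only [Finset.mem_filter, Finset.mem_range]
  omega

theorem sum_pow_mul_pow_of_isPrimitiveRoot {ζ : ℂ} {q b : ℕ} (hζ : IsPrimitiveRoot ζ q)
    (hb : b < q) (k : ℕ) {i : ℕ} (hi : i < q) :
    ∑ j ∈ Finset.range q, ζ ^ (j * (q - b)) * (ζ ^ j) ^ (k * q + i) =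
      if i = b then (q : ℂ) else 0 := by
  have h1 : ∀ j, ζ ^ (j * (q - b)) * (ζ ^ j) ^ (k * q + i) = (ζ ^ (q - b + i)) ^ j := by
    intro j
    have : j * (q - b) + j * (k * q + i) = (q - b + i) * j + q * (k * j) := by ring
    rw [← pow_mul, ← pow_add, this, pow_add, pow_mul ζ q, hζ.pow_eq_one, one_pow, mul_one, pow_mul]
  simp only [h1]
  split_ifs with hib
  · subst hib
    have : q - i + i = q := by omega
    simp [this, hζ.pow_eq_one]
  · have hne : ζ ^ (q - b + i) ≠ 1 := by
      intro h
      obtain ⟨c, hc⟩ := (hζ.pow_eq_one_iff_dvd _).1 h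
      have hc1 : c = 1 := by
        have h2 : 0 < q * c := by omega
        have h3 : q * c < q * 2 := by omega
        have := Nat.pos_of_mul_pos_left h2
        have := Nat.lt_of_mul_lt_mul_left h3
        omega
      subst hc1
      omega
    have := mul_geom_sum (ζ ^ (q - b + i)) q
    rw [← pow_mul, mul_comm (q - b + i), pow_mul, hζ.pow_eq_one, one_pow, sub_self] at this
    exact (mul_eq_zero.1 this).resolve_left (sub_ne_zero.2 hne)

theorem one_sub_mem_slitPlane {z : ℂ} (hz : ‖z‖ = 1) (hz1 : z ≠ 1) : 1 - z ∈ Complex.slitPlane := by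
  left
  have h1 : z.re ≤ 1 := hz ▸ Complex.re_le_norm z
  rcases h1.lt_or_eq with h | h
  · simpa using h
  · have := Complex.sq_norm z
    rw [hz, Complex.normSq_apply, h] at this
    have him : z.im = 0 := by nlinarith
    exact absurd (Complex.ext (by simpa using h) (by simpa using him)) hz1

/-- A conditionally convergent series with periodic numerators is a linear form in logarithms. -/
theorem sum_mul_log_one_sub_eq {ζ : ℂ} {q b₁ b₂ : ℕ} (hζ : IsPrimitiveRoot ζ q)
    (hb₁ : b₁ < q) (hb₂ : b₂ < q) {l : ℂ}
    (hl : HasSum (fun k : ℕ => (q : ℂ) / ((k * q + b₂ : ℕ) : ℂ) - q / ((k * q + b₁ : ℕ) : ℂ)) l) :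
    ∑ j ∈ Finset.range q, (ζ ^ (j * (q - b₁)) - ζ ^ (j * (q - b₂))) * Complex.log (1 - ζ ^ j) =
      l := by
  have hq : q ≠ 0 := by omega
  have hnorm : ‖ζ‖ = 1 := hζ.norm'_eq_one hq
  set c : ℕ → ℂ := fun j => ζ ^ (j * (q - b₁)) - ζ ^ (j * (q - b₂)) with hc
  set f : ℕ → ℂ := fun n => ∑ j ∈ Finset.range q, c j * ((ζ ^ j) ^ n / n) with hf
  have hf0 : Tendsto f atTop (𝓝 0) := by
    rw [← Finset.sum_const_zero (s := Finset.range q)]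
    refine tendsto_finsetSum _ fun j _ => ?_
    rw [← mul_zero (c j)]
    refine Tendsto.const_mul _ ?_
    refine squeeze_zero_norm (fun n => ?_) (tendsto_one_div_atTop_nhds_zero_nat (𝕜 := ℝ))
    simp [hnorm]
  have hblock : ∀ k, ∑ i ∈ Finset.range q, f (k * q + i) =
      -((q : ℂ) / ((k * q + b₂ : ℕ) : ℂ) - q / ((k * q + b₁ : ℕ) : ℂ)) := by
    intro k
    have h1 : ∀ i ∈ Finset.range q, f (k * q + i) =
        ((if i = b₁ then (q : ℂ) else 0) - (if i = b₂ then (q : ℂ) else 0)) /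
          ((k * q + i : ℕ) : ℂ) := by
      intro i hi
      rw [← sum_pow_mul_pow_of_isPrimitiveRoot hζ hb₁ k (Finset.mem_range.1 hi),
        ← sum_pow_mul_pow_of_isPrimitiveRoot hζ hb₂ k (Finset.mem_range.1 hi),
        ← Finset.sum_sub_distrib, Finset.sum_div]
      refine Finset.sum_congr rfl fun j _ => ?_
      rw [hc]
      ring
    rw [Finset.sum_congr rfl h1]
    simp only [sub_div, ite_div, zero_div, Finset.sum_sub_distrib, Finset.sum_ite_eq',
      Finset.mem_range, hb₁, hb₂, if_true]
    ring
  have hpartial : Tendsto (fun n => ∑ i ∈ Finset.range n, f i) atTop (𝓝 (-l)) := by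
    refine tendsto_sum_range_of_tendsto_sum_blocks hq hf0 ?_
    simp only [hblock, Finset.sum_neg_distrib]
    exact hl.tendsto_sum_nat.neg
  have habel := tendsto_map'_iff.1 (Complex.tendsto_tsum_powerSeries_nhdsWithin_lt hpartial)
  have hlog : Tendsto (fun r : ℝ => ∑ j ∈ Finset.range q, c j * -Complex.log (1 - r * ζ ^ j))
      (𝓝[<] 1) (𝓝 (∑ j ∈ Finset.range q, c j * -Complex.log (1 - ζ ^ j))) := by
    refine tendsto_finsetSum _ fun j hj => ?_
    rcases Nat.eq_zero_or_pos j with rfl | hj0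
    · simp [hc]
    refine Tendsto.const_mul _ (Tendsto.neg ?_)
    have hne : ζ ^ j ≠ 1 := hζ.pow_ne_one_of_pos_of_lt hj0.ne' (Finset.mem_range.1 hj)
    have hcont : ContinuousAt (fun r : ℝ => Complex.log (1 - r * ζ ^ j)) 1 := by
      refine ContinuousAt.clog (by fun_prop) ?_
      simpa using one_sub_mem_slitPlane (by simp [hnorm]) hne
    have := hcont.tendsto
    simp only [Complex.ofReal_one, one_mul] at this
    exact this.mono_left nhdsWithin_le_nhds
  have heq : (fun r : ℝ => ∑ j ∈ Finset.range q, c j * -Complex.log (1 - r * ζ ^ j)) =ᶠ[𝓝[<] 1]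
      (fun z : ℂ => ∑' n, f n * z ^ n) ∘ Complex.ofReal := by
    filter_upwards [Ioo_mem_nhdsLT (zero_lt_one (α := ℝ))] with r hr
    have hsum : ∀ j ∈ Finset.range q, HasSum (fun n : ℕ => c j * ((r * ζ ^ j) ^ n / n))
        (c j * -Complex.log (1 - r * ζ ^ j)) := fun j _ => by
      refine HasSum.mul_left _ (Complex.hasSum_taylorSeries_neg_log ?_)
      simp [hnorm, abs_of_pos hr.1, hr.2]
    rw [Function.comp_apply, ← (hasSum_sum hsum).tsum_eq]
    refine tsum_congr fun n => ?_
    rw [hf, Finset.sum_mul]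
    refine Finset.sum_congr rfl fun j _ => ?_
    rw [mul_pow]
    ring
  have huniq := tendsto_nhds_unique (hlog.congr' heq) habel
  simp only [mul_neg, Finset.sum_neg_distrib, neg_inj] at huniq
  exact huniq

end LogSeries

section Digamma

open NumberField

/-- A linear combination of logarithms of algebraic integers with algebraic integer coefficients is
never a nonzero rational integer. -/
theorem sum_isIntegral_mul_log_ne_intCast {ι : Type} [Fintype ι] {m : ℤ} (hm : m ≠ 0)
    {α γ ℓ : ι → ℂ} (hα : ∀ i, IsIntegral ℤ (α i)) (hγ : ∀ i, IsIntegral ℤ (γ i))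
    (hℓ : ∀ i, Complex.exp (ℓ i) = α i) : ∑ i, γ i * ℓ i ≠ m := by
  let K := IntermediateField.adjoin ℚ (Set.range α ∪ Set.range γ)
  have hfin : FiniteDimensional ℚ K := by
    have : Finite ↥(Set.range α ∪ Set.range γ) :=
      ((Set.finite_range α).union (Set.finite_range γ)).to_subtype
    refine IntermediateField.finiteDimensional_adjoin fun x hx => ?_
    rcases hx with ⟨i, rfl⟩ | ⟨i, rfl⟩
    · exact (hα i).tower_top
    · exact (hγ i).tower_top
  have : NumberField K := ⟨⟩
  have hmem : ∀ x ∈ Set.range α ∪ Set.range γ, x ∈ K := fun x hx =>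
    IntermediateField.subset_adjoin ℚ _ hx
  have hintegral : ∀ x : K, IsIntegral ℤ (x : ℂ) → IsIntegral ℤ x := fun x hx =>
    (isIntegral_algHom_iff (K.val.restrictScalars ℤ) K.val.injective).1 hx
  let a : ι → 𝓞 K := fun i => ⟨⟨α i, hmem _ (Or.inl ⟨i, rfl⟩)⟩, hintegral _ (hα i)⟩
  let c : ι → 𝓞 K := fun i => ⟨⟨γ i, hmem _ (Or.inr ⟨i, rfl⟩)⟩, hintegral _ (hγ i)⟩
  exact sum_mul_log_ne_intCast (K.val : K →+* ℂ) hm a c ℓ hℓ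

theorem summable_one_div_sub_one_div {x : ℝ} (hx : 0 < x) :
    Summable fun k : ℕ => 1 / ((k : ℝ) + 1) - 1 / (((k : ℝ) + 1) + x) := by
  have h1 : Summable fun k : ℕ => x * (1 / ((k + 1 : ℕ) : ℝ) ^ 2) :=
    ((summable_nat_add_iff 1).2 (Real.summable_one_div_nat_pow.2 one_lt_two)).mul_left x
  refine Summable.of_nonneg_of_le (fun k => ?_) (fun k => ?_) h1
  · rw [sub_nonneg]
    exact one_div_le_one_div_of_le (by positivity) (by linarith)
  · push_cast
    rw [div_sub_div _ _ (by positivity) (by positivity), mul_one_div,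
      div_le_div_iff₀ (by positivity) (by positivity)]
    have : (0 : ℝ) < (k : ℝ) + 1 := by positivity
    nlinarith [mul_pos (mul_pos hx this) hx, mul_pos this this]

theorem hasSum_digamma_sub {x y : ℝ} (hx : 0 < x) (hy : 0 < y) :
    HasSum (fun k : ℕ => 1 / ((k : ℝ) + y) - 1 / ((k : ℝ) + x)) (digamma x - digamma y) := by
  have h1 := (summable_one_div_sub_one_div hx).hasSum.sub (summable_one_div_sub_one_div hy).hasSum
  rw [← hasSum_nat_add_iff' 1]
  convert h1 using 1
  · funext k
    push_cast
    ring
  · simp [digamma]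
    ring

theorem digamma_lt_digamma {x y : ℝ} (hx : 0 < x) (hxy : x < y) : digamma x < digamma y := by
  have h := hasSum_digamma_sub (hx.trans hxy) hx
  rw [← sub_pos, ← h.tsum_eq]
  have hpos : ∀ k : ℕ, 0 < 1 / ((k : ℝ) + x) - 1 / ((k : ℝ) + y) := fun k => by
    rw [sub_pos]
    exact one_div_lt_one_div_of_lt (by positivity) (by linarith)
  exact h.summable.tsum_pos (fun k => (hpos k).le) 0 (hpos 0)

theorem digamma_sub_digamma_eq_sum_log {ζ : ℂ} {q b₁ b₂ : ℕ} (hζ : IsPrimitiveRoot ζ q)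
    (hb₁ : 0 < b₁) (hb₁' : b₁ < q) (hb₂ : 0 < b₂) (hb₂' : b₂ < q) :
    ∑ j ∈ Finset.range q, (ζ ^ (j * (q - b₁)) - ζ ^ (j * (q - b₂))) * Complex.log (1 - ζ ^ j) =
      ((digamma (b₁ / q) - digamma (b₂ / q) : ℝ) : ℂ) := by
  have hq : (0 : ℝ) < q := by exact_mod_cast (by omega : 0 < q)
  refine sum_mul_log_one_sub_eq hζ hb₁' hb₂' ?_
  have h := hasSum_digamma_sub (x := b₁ / q) (y := b₂ / q) (by positivity) (by positivity)
  have h' : ∀ b : ℕ, 0 < b → ∀ k : ℕ,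
      1 / ((k : ℝ) + b / q) = q / ((k * q + b : ℕ) : ℝ) := fun b hb k => by
    push_cast
    field_simp
  simp only [h' _ hb₁, h' _ hb₂] at h
  simpa using Complex.hasSum_ofReal.2 h

/-- Distinct values of the digamma function at fractions in `(0, 1)` with a common denominator
differ by a transcendental number. -/
theorem transcendental_digamma_sub_digamma {q b₁ b₂ : ℕ} (hb₁ : 0 < b₁) (hb₁' : b₁ < q)
    (hb₂ : 0 < b₂) (hb₂' : b₂ < q) (hne : b₁ ≠ b₂) :
    Transcendental ℚ (digamma (b₁ / q) - digamma (b₂ / q)) := by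
  have hq : (0 : ℝ) < q := by exact_mod_cast (by omega : 0 < q)
  have hζ := Complex.isPrimitiveRoot_exp q (by omega)
  set ζ := Complex.exp (2 * Real.pi * Complex.I / q) with hζdef
  have hsum := digamma_sub_digamma_eq_sum_log hζ hb₁ hb₁' hb₂ hb₂'
  set β := digamma (b₁ / q) - digamma (b₂ / q) with hβ
  have hβ0 : (β : ℂ) ≠ 0 := by
    rw [Complex.ofReal_ne_zero, hβ, sub_ne_zero]
    have key : ∀ {b b' : ℕ}, 0 < b → b < b' → digamma (b / q) < digamma (b' / q) := fun hb h =>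
      digamma_lt_digamma (by positivity) (by gcongr)
    rcases hne.lt_or_gt with h | h
    · exact (key hb₁ h).ne
    · exact (key hb₂ h).ne'
  intro halg
  have halg' : IsAlgebraic ℤ ((β : ℂ)⁻¹) :=
    (IsFractionRing.isAlgebraic_iff ℤ ℚ ℂ).2 (halg.algebraMap (A := ℂ)).inv
  obtain ⟨D, hD0, hD⟩ := halg'.exists_integral_multiple
  have hζint : IsIntegral ℤ ζ := hζ.isIntegral (by omega)
  obtain ⟨p, rfl⟩ : ∃ p, q = p + 1 := ⟨q - 1, by omega⟩
  refine sum_isIntegral_mul_log_ne_intCast (ι := Fin p) hD0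
    (α := fun j => 1 - ζ ^ ((j : ℕ) + 1))
    (γ := fun j => (ζ ^ (((j : ℕ) + 1) * (p + 1 - b₁)) - ζ ^ (((j : ℕ) + 1) * (p + 1 - b₂))) *
      (D • (β : ℂ)⁻¹))
    (ℓ := fun j => Complex.log (1 - ζ ^ ((j : ℕ) + 1)))
    (fun j => isIntegral_one.sub (hζint.pow _))
    (fun j => ((hζint.pow _).sub (hζint.pow _)).mul hD)
    (fun j => Complex.exp_log (sub_ne_zero.2
      (hζ.pow_ne_one_of_pos_of_lt (by omega) (by omega)).symm)) ?_
  rw [Finset.sum_range_succ'] at hsum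
  simp only [zero_mul, pow_zero, sub_self, add_zero] at hsum
  rw [Finset.sum_range] at hsum
  calc _ = (∑ j : Fin p, (ζ ^ (((j : ℕ) + 1) * (p + 1 - b₁)) -
        ζ ^ (((j : ℕ) + 1) * (p + 1 - b₂))) * Complex.log (1 - ζ ^ ((j : ℕ) + 1))) *
          (D • (β : ℂ)⁻¹) := by
        rw [Finset.sum_mul]
        exact Finset.sum_congr rfl fun j _ => by ring
    _ = D := by
        rw [hsum, zsmul_eq_mul]
        field_simp

end Digamma

/-- For `q₁, q₂ > 1`, `1 ≤ aᵢ < qᵢ`, `gcd(aᵢ, qᵢ) = 1` and `a₁/q₁ ≠ a₂/q₂`,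
the number `ψ(a₁/q₁) - ψ(a₂/q₂)` is transcendental. -/
theorem digamma_difference_transcendental (q₁ q₂ a₁ a₂ : ℕ)
    (hq₁ : 1 < q₁) (hq₂ : 1 < q₂)
    (ha₁ : 1 ≤ a₁) (ha₁' : a₁ < q₁) (hgcd₁ : Nat.gcd a₁ q₁ = 1)
    (ha₂ : 1 ≤ a₂) (ha₂' : a₂ < q₂) (hgcd₂ : Nat.gcd a₂ q₂ = 1)
    (hne : (a₁ : ℝ) / (q₁ : ℝ) ≠ (a₂ : ℝ) / (q₂ : ℝ)) :
    Transcendental ℚ (digamma ((a₁ : ℝ) / (q₁ : ℝ)) - digamma ((a₂ : ℝ) / (q₂ : ℝ))) := by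
  have h₁ : (q₁ : ℝ) ≠ 0 := by exact_mod_cast (by omega : q₁ ≠ 0)
  have h₂ : (q₂ : ℝ) ≠ 0 := by exact_mod_cast (by omega : q₂ ≠ 0)
  have e₁ : (a₁ : ℝ) / q₁ = ((a₁ * q₂ : ℕ) : ℝ) / ((q₁ * q₂ : ℕ) : ℝ) := by
    push_cast
    field_simp
  have e₂ : (a₂ : ℝ) / q₂ = ((a₂ * q₁ : ℕ) : ℝ) / ((q₁ * q₂ : ℕ) : ℝ) := by
    push_cast
    field_simp
  rw [e₁, e₂] at hne ⊢
  refine transcendental_digamma_sub_digamma (by positivity) (by gcongr) (by positivity) ?_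
    fun h => hne (by rw [h])
  rw [mul_comm q₁]
  gcongr
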